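/- Discrete mass conservation of the Crank–Nicolson scheme for the mass-conservative Allen–Cahn equation: let N ≥ 1, h > 0, Δt > 0, ε ∈ ℝ, and f : ℝ → ℝ. Suppose two grid functions U, V : ZMod N × ZMod N → ℝ satisfy, for every grid point (i,j), (V(i,j) - U(i,j))/Δt = ε²·(Δ_h((V + U)/2))(i,j) + (f(V(i,j)) + f(U(i,j)))/2 - g(U,V), where g(U,V) = (1/N²)·∑_{(i',j')} (f(V(i',j')) + f(U(i',j')))/2. Then the discrete mass is preserved: ∑_{(i,j)} V(i,j) = ∑_{(i,j)} U(i,j). -/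

import Mathlib

/-- The periodic discrete Laplacian with mesh size `h` on grid functions
`U : ZMod N × ZMod N → ℝ` (index arithmetic modulo `N`). -/
noncomputable def discreteLaplacian (N : ℕ) (h : ℝ) (U : ZMod N × ZMod N → ℝ) :
    ZMod N × ZMod N → ℝ := fun p =>
  (U (p.1 + 1, p.2) + U (p.1 - 1, p.2) + U (p.1, p.2 + 1) + U (p.1, p.2 - 1)
      - 4 * U p) / h ^ 2

theorem sum_discreteLaplacian (N : ℕ) [NeZero N] (h : ℝ) (W : ZMod N × ZMod N → ℝ) :
    ∑ p : ZMod N × ZMod N, discreteLaplacian N h W p = 0 := by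
  have key : ∀ a : ZMod N × ZMod N, ∑ p : ZMod N × ZMod N, W (p + a) = ∑ p, W p :=
    fun a => Equiv.sum_comp (Equiv.addRight a) W
  have h1 : ∑ p : ZMod N × ZMod N, W (p.1 + 1, p.2) = ∑ p, W p := by
    rw [← key (1, 0)]
    exact Finset.sum_congr rfl fun p _ => congrArg W (by ext <;> simp)
  have h2 : ∑ p : ZMod N × ZMod N, W (p.1 - 1, p.2) = ∑ p, W p := by
    rw [← key (-1, 0)]
    exact Finset.sum_congr rfl fun p _ => congrArg W (by ext <;> simp [sub_eq_add_neg])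
  have h3 : ∑ p : ZMod N × ZMod N, W (p.1, p.2 + 1) = ∑ p, W p := by
    rw [← key (0, 1)]
    exact Finset.sum_congr rfl fun p _ => congrArg W (by ext <;> simp)
  have h4 : ∑ p : ZMod N × ZMod N, W (p.1, p.2 - 1) = ∑ p, W p := by
    rw [← key (0, -1)]
    exact Finset.sum_congr rfl fun p _ => congrArg W (by ext <;> simp [sub_eq_add_neg])
  unfold discreteLaplacian
  rw [← Finset.sum_div, Finset.sum_sub_distrib, Finset.sum_add_distrib,
    Finset.sum_add_distrib, Finset.sum_add_distrib, h1, h2, h3, h4, ← Finset.mul_sum]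
  ring

/-- Discrete mass conservation of the Crank–Nicolson scheme for the
mass-conservative Allen–Cahn equation. -/
theorem crankNicolson_mass_conservation
    (N : ℕ) (hN : 1 ≤ N) [NeZero N] (h : ℝ) (hh : 0 < h)
    (Δt : ℝ) (hΔt : 0 < Δt) (ε : ℝ) (f : ℝ → ℝ)
    (U V : ZMod N × ZMod N → ℝ)
    (hscheme : ∀ p : ZMod N × ZMod N,
      (V p - U p) / Δt
        = ε ^ 2 * discreteLaplacian N h (fun q => (V q + U q) / 2) p
          + (f (V p) + f (U p)) / 2
          - (1 / (N : ℝ) ^ 2)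
              * ∑ q : ZMod N × ZMod N, (f (V q) + f (U q)) / 2) :
    ∑ p : ZMod N × ZMod N, V p = ∑ p : ZMod N × ZMod N, U p := by
  have hs := Finset.sum_congr (rfl : (Finset.univ : Finset (ZMod N × ZMod N)) = Finset.univ)
    (fun p _ => hscheme p)
  have hN0 : (N : ℝ) ≠ 0 := Nat.cast_ne_zero.mpr (NeZero.ne N)
  rw [← Finset.sum_div, Finset.sum_sub_distrib, Finset.sum_sub_distrib,
    Finset.sum_add_distrib, ← Finset.mul_sum, sum_discreteLaplacian, Finset.sum_const,
    Finset.card_univ, Fintype.card_prod, ZMod.card, nsmul_eq_mul] at hs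
  have hz : ∀ S : ℝ, ε ^ 2 * 0 + S - ((N * N : ℕ) : ℝ) * (1 / (N : ℝ) ^ 2 * S) = 0 := by
    intro S
    push_cast
    field_simp
    ring
  rw [hz, div_eq_zero_iff] at hs
  rcases hs with hs | hs
  · exact sub_eq_zero.mp hs
  · exact absurd hs hΔt.ne'
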